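/- Let p ≥ 2, θ ∈ (−π, π], and α, k ∈ ℝ. Let f(θ) be the p×p complex matrix with zeros on the diagonal, α on the superdiagonal and subdiagonal, α·e^{−iθ} in position (1,p), α·e^{iθ} in position (p,1), and zeros elsewhere; let g(θ) be the p×p complex matrix with k on the subdiagonal, k·e^{−iθ} in position (1,p), and zeros elsewhere. Then the spectrum of f(θ) + g(θ) is exactly { (α+k)·e^{i(2rπ−θ)/p} + α·e^{−i(2rπ−θ)/p} : r = 0, 1, …, p−1 }. -/

import Mathlib

open Matrix

/-- The `p×p` matrix with `α` on the super- and sub-diagonal, `α·e^{-iθ}` in the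
top-right corner and `α·e^{iθ}` in the bottom-left corner (rows/columns indexed `0,…,p-1`). -/
noncomputable def fMat (p : ℕ) (α θ : ℝ) : Matrix (Fin p) (Fin p) ℂ :=
  Matrix.of fun i j =>
    (if (j : ℕ) = (i : ℕ) + 1 then (α : ℂ) else 0)
    + (if (i : ℕ) = (j : ℕ) + 1 then (α : ℂ) else 0)
    + (if (i : ℕ) = 0 ∧ (j : ℕ) = p - 1 then (α : ℂ) * Complex.exp (-(θ : ℂ) * Complex.I) else 0)
    + (if (i : ℕ) = p - 1 ∧ (j : ℕ) = 0 then (α : ℂ) * Complex.exp ((θ : ℂ) * Complex.I) else 0)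

/-- The `p×p` matrix with `k` on the sub-diagonal and `k·e^{-iθ}` in the top-right corner. -/
noncomputable def gMat (p : ℕ) (k θ : ℝ) : Matrix (Fin p) (Fin p) ℂ :=
  Matrix.of fun i j =>
    (if (i : ℕ) = (j : ℕ) + 1 then (k : ℂ) else 0)
    + (if (i : ℕ) = 0 ∧ (j : ℕ) = p - 1 then (k : ℂ) * Complex.exp (-(θ : ℂ) * Complex.I) else 0)

/-- A nonzero `p`-th root `w` of `e^{iθ}` yields the eigenvector `(1, w, …, w^{p-1})`. -/
theorem sum_fMat_add_gMat_mul_pow {p : ℕ} (hp : 2 ≤ p) (α k θ : ℝ) {w : ℂ} (hw0 : w ≠ 0)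
    (hw : w ^ p = Complex.exp ((θ : ℂ) * Complex.I)) (i : Fin p) :
    ∑ j, (fMat p α θ + gMat p k θ) i j * w ^ (j : ℕ) =
      w ^ (i : ℕ) * (((α : ℂ) + k) * w⁻¹ + α * w) := by
  obtain ⟨n, rfl⟩ : ∃ n, p = n + 1 := ⟨p - 1, by omega⟩
  obtain ⟨i, hi⟩ := i
  have hexp : Complex.exp (-((θ : ℂ) * Complex.I)) = (w ^ (n + 1))⁻¹ := by
    rw [hw, Complex.exp_neg]
  simp only [fMat, gMat, Matrix.add_apply, Matrix.of_apply, add_tsub_cancel_right, neg_mul,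
    hexp, ← hw]
  rw [Fin.sum_univ_eq_sum_range (fun j : ℕ =>
    ((if j = i + 1 then (α : ℂ) else 0) + (if i = j + 1 then (α : ℂ) else 0)
      + (if i = 0 ∧ j = n then (α : ℂ) * (w ^ (n + 1))⁻¹ else 0)
      + (if i = n ∧ j = 0 then (α : ℂ) * w ^ (n + 1) else 0)
      + ((if i = j + 1 then (k : ℂ) else 0)
        + (if i = 0 ∧ j = n then (k : ℂ) * (w ^ (n + 1))⁻¹ else 0))) * w ^ j)]
  rcases i with _ | m
  · have hn : (0 : ℕ) ≠ n := by omega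
    have hn' : 0 < n := by omega
    simp [add_mul, Finset.sum_add_distrib, ite_mul, hn, hn']
    field_simp
    ring
  · have hm : m < n + 1 := by omega
    by_cases h : m + 1 = n
    · subst h
      simp [add_mul, Finset.sum_add_distrib, ite_mul]
      field_simp
      ring
    · have h' : m + 1 < n := by omega
      simp [add_mul, Finset.sum_add_distrib, ite_mul, h, h', hm]
      field_simp
      ring

/-- The spectrum of a square matrix with a full set of eigenvectors of the form
`(1, w, …, w^{p-1})` consists of the corresponding eigenvalues. -/
theorem spectrum_eq_range_of_sum_mul_pow {p : ℕ} (M : Matrix (Fin p) (Fin p) ℂ)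
    {w d : Fin p → ℂ} (hw : Function.Injective w)
    (h : ∀ i r, ∑ j, M i j * w r ^ (j : ℕ) = w r ^ (i : ℕ) * d r) :
    spectrum ℂ M = Set.range d := by
  set V : Matrix (Fin p) (Fin p) ℂ := (Matrix.vandermonde w)ᵀ with hV
  have hMV : M * V = V * Matrix.diagonal d := by
    ext i r
    rw [Matrix.mul_diagonal, Matrix.mul_apply]
    exact h i r
  have hunit : IsUnit V := by
    rw [Matrix.isUnit_iff_isUnit_det, hV, Matrix.det_transpose, isUnit_iff_ne_zero]
    exact Matrix.det_vandermonde_ne_zero_iff.2 hw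
  obtain ⟨u, hu⟩ := hunit
  have hM : M = u * Matrix.diagonal d * ((u⁻¹ : (Matrix (Fin p) (Fin p) ℂ)ˣ) :
      Matrix (Fin p) (Fin p) ℂ) := by
    rw [Units.eq_mul_inv_iff_mul_eq, hu, hMV]
  rw [hM, spectrum.units_conjugate, spectrum_diagonal]

theorem exp_neg_root_pow {p : ℕ} (hp : p ≠ 0) (θ : ℝ) (r : ℕ) :
    Complex.exp (-(Complex.I * (((2 * r * Real.pi - θ) / p : ℝ) : ℂ))) ^ p =
      Complex.exp ((θ : ℂ) * Complex.I) := by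
  have hp' : (p : ℂ) ≠ 0 := Nat.cast_ne_zero.2 hp
  rw [← Complex.exp_nat_mul, Complex.exp_eq_exp_iff_exists_int]
  refine ⟨-r, ?_⟩
  push_cast
  field_simp
  ring

theorem injective_exp_neg_root {p : ℕ} (hp : p ≠ 0) (θ : ℝ) :
    Function.Injective fun r : Fin p =>
      Complex.exp (-(Complex.I * (((2 * (r : ℕ) * Real.pi - θ) / p : ℝ) : ℂ))) := by
  intro r s h
  have key (r : ℕ) : Complex.exp (-(Complex.I * (((2 * r * Real.pi - θ) / p : ℝ) : ℂ))) =
      Complex.exp (Complex.I * θ / p) * (Complex.exp (2 * Real.pi * Complex.I / p) ^ r)⁻¹ := by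
    rw [← Complex.exp_nat_mul, ← Complex.exp_neg, ← Complex.exp_add]
    congr 1
    push_cast
    ring
  simp only [key] at h
  exact Fin.ext ((Complex.isPrimitiveRoot_exp p hp).pow_inj r.2 s.2
    (inv_injective (mul_left_cancel₀ (Complex.exp_ne_zero _) h)))

theorem spectrum_fMat_add_gMat (p : ℕ) (hp : 2 ≤ p) (θ : ℝ)
    (hθ : θ ∈ Set.Ioc (-Real.pi) Real.pi) (α k : ℝ) :
    spectrum ℂ (fMat p α θ + gMat p k θ) =
      {z : ℂ | ∃ r : Fin p,
        z = ((α : ℂ) + (k : ℂ)) *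
              Complex.exp (Complex.I * (((2 * (r : ℕ) * Real.pi - θ) / p : ℝ) : ℂ))
          + (α : ℂ) * Complex.exp (-(Complex.I * (((2 * (r : ℕ) * Real.pi - θ) / p : ℝ) : ℂ)))} := by
  have hp0 : p ≠ 0 := by omega
  rw [spectrum_eq_range_of_sum_mul_pow _ (injective_exp_neg_root hp0 θ) fun i r =>
    sum_fMat_add_gMat_mul_pow hp α k θ (Complex.exp_ne_zero _) (exp_neg_root_pow hp0 θ r) i]
  ext z
  simp only [Set.mem_range, Set.mem_ofPred_eq, ← Complex.exp_neg, neg_neg, eq_comm]
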